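/- arXiv:1007.2916 — 2 statements merged into one kernel-verified Lean document; each statement's English description precedes it below -/
import Mathlib

section
/- Let X and Y be separable Banach spaces. If X is an almost Daugavet space, then X ⊕_1 Y (the product with norm ‖(x,y)‖ = ‖x‖ + ‖y‖) is an almost Daugavet space. -/
/-- `Y ⊆ X*` is norming: `sup {|f x| : f ∈ Y, ‖f‖ ≤ 1} = ‖x‖` for every `x`. -/
def IsNormingSubspace {X : Type*} [NormedAddCommGroup X] [NormedSpace ℝ X]
    (Y : Subspace ℝ (X →L[ℝ] ℝ)) : Prop :=
  ∀ x : X, ‖x‖ = sSup {r : ℝ | ∃ f ∈ Y, ‖f‖ ≤ 1 ∧ r = |f x|}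

/-- `X` has the Daugavet property with respect to `Y ⊆ X*`: every rank-one operator
`T = y* ⊗ x` with `y* ∈ Y` satisfies `‖Id + T‖ = 1 + ‖T‖`. -/
def HasDaugavetWrt {X : Type*} [NormedAddCommGroup X] [NormedSpace ℝ X]
    (Y : Subspace ℝ (X →L[ℝ] ℝ)) : Prop :=
  ∀ (x : X), ∀ f ∈ Y,
    ‖ContinuousLinearMap.id ℝ X + ContinuousLinearMap.smulRight f x‖ =
      1 + ‖ContinuousLinearMap.smulRight f x‖

/-- `X` is an almost Daugavet space. -/
def AlmostDaugavet (X : Type*) [NormedAddCommGroup X] [NormedSpace ℝ X] : Prop :=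
  ∃ Y : Subspace ℝ (X →L[ℝ] ℝ), IsNormingSubspace Y ∧ HasDaugavetWrt Y

open Filter Topology

def FinProp (Z : Type*) [NormedAddCommGroup Z] : Prop :=
  ∀ (s : Finset Z) (ε : ℝ), 0 < ε → ∃ e : Z, ‖e‖ ≤ 1 ∧ ∀ z ∈ s, ‖z‖ + 1 - ε < ‖z + e‖

lemma norming_exists {X : Type*} [NormedAddCommGroup X] [NormedSpace ℝ X]
    {W : Subspace ℝ (X →L[ℝ] ℝ)} (hW : IsNormingSubspace W) (x : X) (r : ℝ) (hr : r < ‖x‖) :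
    ∃ f ∈ W, ‖f‖ ≤ 1 ∧ r < f x := by
  rw [hW x] at hr
  have hne : {r : ℝ | ∃ f ∈ W, ‖f‖ ≤ 1 ∧ r = |f x|}.Nonempty :=
    ⟨0, 0, W.zero_mem, by simp, by simp⟩
  obtain ⟨a, ⟨f, hf, hf1, rfl⟩, ha⟩ := exists_lt_of_lt_csSup hne hr
  rcases le_total 0 (f x) with h | h
  · exact ⟨f, hf, hf1, by rwa [abs_of_nonneg h] at ha⟩
  · exact ⟨-f, W.neg_mem hf, by simpa using hf1, by rw [abs_of_nonpos h] at ha; simpa using ha⟩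

lemma exists_ball_lt {E F : Type*} [NormedAddCommGroup E] [NormedSpace ℝ E]
    [NormedAddCommGroup F] [NormedSpace ℝ F] (T : E →L[ℝ] F) (r : ℝ) (hr : r < ‖T‖) :
    ∃ u : E, ‖u‖ ≤ 1 ∧ r < ‖T u‖ := by
  by_contra! h
  have h0 : 0 ≤ r := by simpa using h 0 (by simp)
  have := T.opNorm_le_of_unit_norm h0 (fun x hx => h x hx.le)
  linarith

lemma slice_step {X : Type*} [NormedAddCommGroup X] [NormedSpace ℝ X]
    {W : Subspace ℝ (X →L[ℝ] ℝ)} (hW : IsNormingSubspace W) (hD : HasDaugavetWrt W)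
    (f : X →L[ℝ] ℝ) (hf : f ∈ W) (hf1 : ‖f‖ = 1) (δ : ℝ) (hδ : 0 < δ) (x : X)
    (ε : ℝ) (hε : 0 < ε) :
    ∃ g ∈ W, ‖g‖ = 1 ∧ ∃ δ' > 0, ∀ v, ‖v‖ ≤ 1 → 1 - δ' < g v →
      1 - δ < f v ∧ ‖x‖ + 1 - ε < ‖x + v‖ := by
  by_cases hx : x = 0
  · subst hx
    refine ⟨f, hf, hf1, min δ ε, lt_min hδ hε, fun v hv h => ?_⟩
    have h1 := min_le_left δ ε
    have h2 := min_le_right δ ε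
    have h3 : f v ≤ ‖v‖ := by
      have := f.le_opNorm v
      rw [hf1, one_mul] at this
      exact (le_abs_self _).trans this
    refine ⟨by linarith, ?_⟩
    rw [norm_zero, zero_add, zero_add]; linarith
  have hx0 : 0 < ‖x‖ := norm_pos_iff.2 hx
  obtain ⟨η, hη0, hη1, hη2, hη3⟩ : ∃ η : ℝ, 0 < η ∧ η ≤ δ * ‖x‖ ∧ η < ‖x‖ ∧ 2 * η ≤ ε := by
    refine ⟨min (δ * ‖x‖) (min (‖x‖ / 2) (ε / 2)), by positivity, min_le_left _ _, ?_, ?_⟩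
    · have := (min_le_right (δ * ‖x‖) _).trans (min_le_left (‖x‖ / 2) (ε / 2)); linarith
    · have := (min_le_right (δ * ‖x‖) _).trans (min_le_right (‖x‖ / 2) (ε / 2)); linarith
  have hD' := hD x f hf
  rw [ContinuousLinearMap.norm_smulRight_apply, hf1, one_mul] at hD'
  obtain ⟨u, hu1, hu⟩ : ∃ u : X, ‖u‖ ≤ 1 ∧ 0 ≤ f u ∧ 1 + ‖x‖ - η < ‖u + f u • x‖ := by
    obtain ⟨u, hu1, hu⟩ := exists_ball_lt _ (1 + ‖x‖ - η) (by rw [hD']; linarith)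
    have hu' : 1 + ‖x‖ - η < ‖u + f u • x‖ := by simpa using hu
    rcases le_total 0 (f u) with h | h
    · exact ⟨u, hu1, h, hu'⟩
    · refine ⟨-u, by simpa using hu1, by simpa using h, ?_⟩
      have : -u + f (-u) • x = -(u + f u • x) := by simp; abel
      rw [this, norm_neg]; exact hu'
  obtain ⟨g, hg, hg1, hgu⟩ := norming_exists hW _ _ hu.2
  have gle : ∀ y, |g y| ≤ ‖y‖ := fun y => by
    have := g.le_of_opNorm_le hg1 y
    simpa using this
  have gle' : ∀ y, g y ≤ ‖y‖ := fun y => (le_abs_self _).trans (gle y)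
  have fle : ∀ y, f y ≤ ‖y‖ := fun y => by
    have := f.le_opNorm y
    rw [hf1, one_mul] at this
    exact (le_abs_self _).trans this
  have hgu' : 1 + ‖x‖ - η < g u + f u * g x := by simpa using hgu
  have hgx : 0 < g x := by
    by_contra! hc
    have := gle' u
    nlinarith [hu.1]
  set h : X →L[ℝ] ℝ := g + g x • f with hh
  have hhu : 1 + ‖x‖ - η < h u := by simp [hh]; linarith
  have hhn : 1 + ‖x‖ - η < ‖h‖ := by
    have h1 := h.le_opNorm u
    have h2 : h u ≤ ‖h u‖ := le_abs_self _
    nlinarith [norm_nonneg h]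
  have hhp : 0 < ‖h‖ := by linarith
  refine ⟨‖h‖⁻¹ • h, W.smul_mem _ (W.add_mem hg (W.smul_mem _ hf)), ?_,
    1 - (1 + ‖x‖ - η) / ‖h‖, ?_, fun v hv hgv => ?_⟩
  · rw [norm_smul, norm_inv, norm_norm, inv_mul_cancel₀ hhp.ne']
  · have := (div_lt_one hhp).2 hhn
    linarith
  · have h1 : 1 + ‖x‖ - η < h v := by
      have h2 : (1 + ‖x‖ - η) / ‖h‖ < h v / ‖h‖ := by
        have : (‖h‖⁻¹ • h) v = h v / ‖h‖ := by simp [div_eq_inv_mul]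
        linarith
      exact (div_lt_div_iff_of_pos_right hhp).1 h2
    have h3 : 1 + ‖x‖ - η < g v + f v * g x := by
      have : h v = g v + g x * f v := by simp [hh]
      linarith
    have h4 := gle' v
    have h5 : ‖x‖ - η < f v * g x := by linarith
    have h6 : 0 < f v := by
      by_contra! hc
      nlinarith
    have h7 : f v * g x ≤ f v * ‖x‖ := mul_le_mul_of_nonneg_left (gle' x) h6.le
    have h8 : f v ≤ 1 := (fle v).trans hv
    refine ⟨by by_contra! hc; nlinarith, ?_⟩
    have h9 : g v + f v * g x ≤ ‖v + f v • x‖ := by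
      have := gle' (v + f v • x)
      simpa using this
    have h10 : ‖v + f v • x‖ ≤ ‖x + v‖ + (1 - f v) * ‖x‖ := by
      have : v + f v • x = (x + v) - (1 - f v) • x := by rw [sub_smul, one_smul]; abel
      rw [this]
      refine (norm_sub_le _ _).trans ?_
      rw [norm_smul, Real.norm_of_nonneg (by linarith)]
    nlinarith

lemma finProp_of_almostDaugavet {X : Type*} [NormedAddCommGroup X] [NormedSpace ℝ X]
    (hX : AlmostDaugavet X) : FinProp X := by
  obtain ⟨W, hW, hD⟩ := hX
  have base : ∃ g ∈ W, ‖g‖ = 1 := by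
    have hne : ∃ x : X, 0 < ‖x‖ := by
      by_contra! hc
      have h0 := hD 0 0 W.zero_mem
      have : ContinuousLinearMap.id ℝ X = 0 := by
        ext x; exact norm_le_zero_iff.1 (hc x)
      simp [this] at h0
    obtain ⟨x, hx⟩ := hne
    obtain ⟨f, hf, -, hfx⟩ := norming_exists hW x 0 hx
    have hfn : ‖f‖ ≠ 0 := by
      intro h; rw [norm_eq_zero] at h; simp [h] at hfx
    exact ⟨‖f‖⁻¹ • f, W.smul_mem _ hf, by
      rw [norm_smul, norm_inv, norm_norm, inv_mul_cancel₀ hfn]⟩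
  intro s ε hε
  have key : ∃ g ∈ W, ‖g‖ = 1 ∧ ∃ δ > 0, ∀ v, ‖v‖ ≤ 1 → 1 - δ < g v →
      ∀ z ∈ s, ‖z‖ + 1 - ε < ‖z + v‖ := by
    classical
    induction s using Finset.induction_on with
    | empty =>
      obtain ⟨g, hg, hg1⟩ := base
      exact ⟨g, hg, hg1, 1, one_pos, by simp⟩
    | insert a s _ ih =>
      obtain ⟨f, hf, hf1, δ, hδ, H⟩ := ih
      obtain ⟨g, hg, hg1, δ', hδ', H'⟩ := slice_step hW hD f hf hf1 δ hδ a ε hε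
      refine ⟨g, hg, hg1, δ', hδ', fun v hv hgv z hz => ?_⟩
      obtain ⟨h1, h2⟩ := H' v hv hgv
      rcases Finset.mem_insert.1 hz with rfl | hz
      · exact h2
      · exact H v hv h1 z hz
  obtain ⟨g, -, hg1, δ, hδ, H⟩ := key
  obtain ⟨u, hu, hgu⟩ := exists_ball_lt g (1 - δ) (by linarith)
  rw [Real.norm_eq_abs] at hgu
  rcases abs_cases (g u) with h | h
  · exact ⟨u, hu, H u hu (by linarith)⟩
  · exact ⟨-u, by simpa using hu, H (-u) (by simpa using hu) (by rw [map_neg]; linarith)⟩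

lemma finProp_sum {X Y : Type*} [NormedAddCommGroup X] [NormedAddCommGroup Y]
    (hX : FinProp X) : FinProp (WithLp 1 (X × Y)) := by
  classical
  intro s ε hε
  obtain ⟨e, he, H⟩ := hX (s.image fun z => z.fst) ε hε
  refine ⟨WithLp.toLp 1 (e, 0), ?_, fun z hz => ?_⟩
  · simpa [WithLp.prod_norm_eq_of_L1] using he
  · have := H z.fst (Finset.mem_image_of_mem _ hz)
    have h1 : ‖z + WithLp.toLp 1 (e, (0 : Y))‖ = ‖z.fst + e‖ + ‖z.snd‖ := by
      simp [WithLp.prod_norm_eq_of_L1]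
    have h2 : ‖z‖ = ‖z.fst‖ + ‖z.snd‖ := WithLp.prod_norm_eq_of_L1 z
    rw [h1, h2]
    linarith

lemma finProp_span {Z : Type*} [NormedAddCommGroup Z] [NormedSpace ℝ Z] (hZ : FinProp Z)
    (s : Finset Z) (q : ℝ) (hq0 : 0 < q) (hq : q < 1) :
    ∃ e : Z, ‖e‖ ≤ 1 ∧ ∀ z ∈ Submodule.span ℝ (s : Set Z), ∀ t : ℝ,
      q * (‖z‖ + |t|) ≤ ‖z + t • e‖ := by
  classical
  set E := Submodule.span ℝ (s : Set Z) with hE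
  have : FiniteDimensional ℝ E := FiniteDimensional.span_finset ℝ s
  have : ProperSpace E := FiniteDimensional.proper_real E
  set η := (1 - q) / 3 with hη
  have hη0 : 0 < η := by rw [hη]; linarith
  have htb := (isCompact_closedBall (0 : E) (2 / (1 - q))).totallyBounded
  obtain ⟨T, hT, hcov⟩ := Metric.totallyBounded_iff.1 htb η hη0
  obtain ⟨e, he, H⟩ := hZ (hT.toFinset.image fun z : E => (z : Z)) η hη0
  have main : ∀ z ∈ E, q * (‖z‖ + 1) ≤ ‖z + e‖ := by
    intro z hz
    by_cases hb : ‖z‖ ≤ 2 / (1 - q)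
    · have hm : (⟨z, hz⟩ : E) ∈ Metric.closedBall (0 : E) (2 / (1 - q)) := by
        simpa using hb
      have := hcov hm
      simp only [Set.mem_iUnion] at this
      obtain ⟨y, hy, hzy⟩ := this
      have h1 := H y (Finset.mem_image_of_mem _ (hT.mem_toFinset.2 hy))
      have h2 : ‖z - y‖ < η := by
        rw [Metric.mem_ball, dist_eq_norm] at hzy
        exact hzy
      have h3 : ‖(y : Z) + e‖ ≤ ‖z + e‖ + ‖z - y‖ := by
        have : (y : Z) + e = (z + e) - (z - y) := by abel
        rw [this]; exact norm_sub_le _ _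
      have h4 : ‖z‖ ≤ ‖(y : Z)‖ + ‖z - y‖ := by
        have : z = (y : Z) + (z - y) := by abel
        calc ‖z‖ = ‖(y : Z) + (z - y)‖ := by rw [← this]
          _ ≤ _ := norm_add_le _ _
      nlinarith [norm_nonneg z]
    · push Not at hb
      rw [div_lt_iff₀ (by linarith)] at hb
      have : ‖z‖ ≤ ‖z + e‖ + ‖e‖ := by
        calc ‖z‖ = ‖(z + e) - e‖ := by simp
          _ ≤ _ := norm_sub_le _ _
      nlinarith
  refine ⟨e, he, fun z hz t => ?_⟩
  by_cases ht : t = 0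
  · subst ht
    simp only [abs_zero, add_zero, zero_smul]
    nlinarith [norm_nonneg z]
  · have h1 := main (t⁻¹ • z) (E.smul_mem _ hz)
    have h2 : z + t • e = t • (t⁻¹ • z + e) := by
      rw [smul_add, smul_inv_smul₀ ht]
    have h3 : ‖z‖ = |t| * ‖t⁻¹ • z‖ := by
      rw [← Real.norm_eq_abs, ← norm_smul, smul_inv_smul₀ ht]
    rw [h2, norm_smul, Real.norm_eq_abs, h3]
    nlinarith [abs_nonneg t]

lemma extend_step {Z : Type*} [NormedAddCommGroup Z] [NormedSpace ℝ Z]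
    (E : Submodule ℝ Z) (e : Z) (q : ℝ) (hq0 : 0 < q)
    (H : ∀ z ∈ E, ∀ t : ℝ, q * (‖z‖ + |t|) ≤ ‖z + t • e‖)
    (f : Z →L[ℝ] ℝ) (a : ℝ) (ha : |a| ≤ ‖f‖) :
    ∃ g : Z →L[ℝ] ℝ, (∀ z ∈ E, g z = f z) ∧ g e = a ∧ ‖g‖ * q ≤ ‖f‖ := by
  have heE : e ∉ E := by
    intro he
    have := H (-e) (E.neg_mem he) 1
    simp at this
    nlinarith [norm_nonneg e]
  let p : Z →ₗ.[ℝ] ℝ := ⟨E, (f : Z →ₗ[ℝ] ℝ).comp E.subtype⟩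
  have hep : e ∉ p.domain := heE
  let p' := p.supSpanSingleton e a hep
  obtain ⟨g, hg1, hg2⟩ := exists_extension_of_le_sublinear p' (fun z => ‖f‖ / q * ‖z‖)
    (fun c hc x => by rw [norm_smul, Real.norm_of_nonneg hc.le]; ring)
    (fun x y => by
      rw [← mul_add]
      exact mul_le_mul_of_nonneg_left (norm_add_le _ _) (by positivity))
    (by
      rintro ⟨x, hx⟩
      have hx' : x ∈ p.domain ⊔ Submodule.span ℝ {e} := hx
      obtain ⟨z, hz, w, hw, rfl⟩ := Submodule.mem_sup.1 hx'
      obtain ⟨t, rfl⟩ := Submodule.mem_span_singleton.1 hw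
      have h1 : p' ⟨z + t • e, hx⟩ = f z + t * a :=
        p.supSpanSingleton_apply_mk e a hep z hz t
      rw [h1]
      have h2 := H z hz t
      have h3 : f z ≤ ‖f‖ * ‖z‖ := (le_abs_self _).trans (f.le_opNorm z)
      have h4 : t * a ≤ |t| * ‖f‖ := by
        refine (le_abs_self _).trans ?_
        rw [abs_mul]
        exact mul_le_mul_of_nonneg_left ha (abs_nonneg t)
      have h5 : ‖f‖ / q * (q * (‖z‖ + |t|)) = ‖f‖ * (‖z‖ + |t|) := by field_simp
      have h6 := mul_le_mul_of_nonneg_left h2 (show 0 ≤ ‖f‖ / q by positivity)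
      show f z + t * a ≤ ‖f‖ / q * ‖z + t • e‖
      nlinarith)
  have hb : ∀ z, ‖g z‖ ≤ ‖f‖ / q * ‖z‖ := by
    intro z
    have h1 := hg2 z
    have h2 := hg2 (-z)
    simp only [map_neg, norm_neg] at h1 h2
    rw [Real.norm_eq_abs, abs_le]
    constructor <;> linarith
  have hmem : ∀ z ∈ E, ∀ t : ℝ, g (z + t • e) = f z + t * a := by
    intro z hz t
    have hx : z + t • e ∈ p'.domain := by
      show z + t • e ∈ p.domain ⊔ Submodule.span ℝ {e}
      exact Submodule.add_mem_sup hz (Submodule.smul_mem _ _ (Submodule.mem_span_singleton_self e))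
    have := hg1 ⟨_, hx⟩
    simp only at this
    rw [this]
    exact p.supSpanSingleton_apply_mk e a hep z hz t
  refine ⟨g.mkContinuous _ hb, fun z hz => ?_, ?_, ?_⟩
  · simpa using hmem z hz 0
  · simpa using hmem 0 E.zero_mem 1
  · have := g.mkContinuous_norm_le (show 0 ≤ ‖f‖ / q by positivity) hb
    rwa [le_div_iff₀ hq0] at this

lemma exists_limit {Z : Type*} [NormedAddCommGroup Z] [NormedSpace ℝ Z]
    (F : ℕ → Z →L[ℝ] ℝ) (C : ℝ) (hC : ∀ i, ‖F i‖ ≤ C) :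
    ∃ f : Z →L[ℝ] ℝ, ‖f‖ ≤ C ∧ ∀ z c, (∀ᶠ i in atTop, F i z = c) → f z = c := by
  have hC0 : 0 ≤ C := (norm_nonneg _).trans (hC 0)
  let U : Ultrafilter ℕ := hyperfilter ℕ
  have hU : (U : Filter ℕ) ≤ atTop := by
    have := hyperfilter_le_cofinite (α := ℕ)
    rwa [Nat.cofinite_eq_atTop] at this
  have hb : ∀ i z, ‖F i z‖ ≤ C * ‖z‖ := fun i z => (F i).le_of_opNorm_le (hC i) z
  have ex : ∀ z, ∃ c : ℝ, ‖c‖ ≤ C * ‖z‖ ∧ Tendsto (fun i => F i z) U (𝓝 c) := by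
    intro z
    have hK := isCompact_closedBall (0 : ℝ) (C * ‖z‖)
    obtain ⟨c, hc, h⟩ := hK.ultrafilter_le_nhds (U.map fun i => F i z) (by
      rw [le_principal_iff]
      exact Eventually.of_forall (f := (U : Filter ℕ)) fun i => by simpa using hb i z)
    exact ⟨c, by simpa using hc, h⟩
  choose L hL1 hL2 using ex
  let l : Z →ₗ[ℝ] ℝ :=
    { toFun := L
      map_add' := fun x y => by
        refine tendsto_nhds_unique (hL2 (x + y)) ?_
        simpa using (hL2 x).add (hL2 y)
      map_smul' := fun c x => by
        refine tendsto_nhds_unique (hL2 (c • x)) ?_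
        simpa using (hL2 x).const_mul c }
  refine ⟨l.mkContinuous C hL1, l.mkContinuous_norm_le hC0 hL1, fun z c h => ?_⟩
  show L z = c
  refine tendsto_nhds_unique (hL2 z) ?_
  refine Tendsto.congr' ?_ tendsto_const_nhds
  exact (h.filter_mono hU).mono fun i hi => hi.symm

lemma exists_system {Z : Type*} [NormedAddCommGroup Z] [NormedSpace ℝ Z] (hZ : FinProp Z)
    (x : ℕ → Z) (q : ℕ → ℝ) (hq0 : ∀ k, 0 < q k) (hq : ∀ k, q k < 1) :
    ∃ (E : ℕ → Submodule ℝ Z) (e : ℕ → Z), Monotone E ∧ (∀ k, e k ∈ E (k + 1)) ∧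
      (∀ j k, j ≤ k → x j ∈ E k) ∧ (∀ k, ‖e k‖ ≤ 1) ∧
      ∀ k, ∀ z ∈ E k, ∀ t : ℝ, q k * (‖z‖ + |t|) ≤ ‖z + t • e k‖ := by
  classical
  choose pick hp1 hp2 using fun (s : Finset Z) (k : ℕ) => finProp_span hZ s (q k) (hq0 k) (hq k)
  obtain ⟨S, hS0, hS⟩ : ∃ S : ℕ → Finset Z, S 0 = {x 0} ∧
      ∀ k, S (k + 1) = insert (x (k + 1)) (insert (pick (S k) k) (S k)) :=
    ⟨fun k => Nat.rec {x 0} (fun k s => insert (x (k + 1)) (insert (pick s k) s)) k,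
      rfl, fun k => rfl⟩
  let G : ℕ → Submodule ℝ Z := fun k => Submodule.span ℝ (↑(S k) : Set Z)
  have hmono : Monotone G := by
    refine monotone_nat_of_le_succ fun k : ℕ => Submodule.span_mono ?_
    rw [hS]
    intro z hz
    simp only [Finset.coe_insert, Set.mem_insert_iff]
    exact Or.inr (Or.inr hz)
  refine ⟨G, fun k => pick (S k) k, hmono, fun k => ?_,
    fun j k hjk => hmono hjk ?_, fun k => hp1 _ _, fun k => hp2 _ _⟩
  · exact Submodule.subset_span (by rw [hS]; simp)
  · refine Submodule.subset_span ?_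
    cases j with
    | zero => simp [hS0]
    | succ j => rw [hS]; simp

lemma almostDaugavet_of_finProp {Z : Type*} [NormedAddCommGroup Z] [NormedSpace ℝ Z]
    [TopologicalSpace.SeparableSpace Z] (hZ : FinProp Z) : AlmostDaugavet Z := by
  -- dense sequence in the unit ball
  have : SecondCountableTopology Z := UniformSpace.secondCountable_of_separable Z
  have : Nonempty (Metric.closedBall (0 : Z) 1) := ⟨⟨0, by simp⟩⟩
  obtain ⟨x, hx1, hxd⟩ : ∃ x : ℕ → Z, (∀ n, ‖x n‖ ≤ 1) ∧
      ∀ w : Z, ‖w‖ ≤ 1 → ∀ η > 0, ∃ n, ‖w - x n‖ < η := by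
    refine ⟨fun n => (TopologicalSpace.denseSeq (Metric.closedBall (0 : Z) 1) n : Z),
      fun n => ?_, fun w hw η hη => ?_⟩
    · exact mem_closedBall_zero_iff.1 (TopologicalSpace.denseSeq (Metric.closedBall (0 : Z) 1) n).2
    · obtain ⟨n, hn⟩ := (TopologicalSpace.denseRange_denseSeq
        (Metric.closedBall (0 : Z) 1)).exists_dist_lt ⟨w, by simpa using hw⟩ hη
      exact ⟨n, by rw [Subtype.dist_eq, dist_eq_norm] at hn; exact hn⟩
  let b : ℕ → ℝ := fun k => 1 + 1 / ((k : ℝ) + 1)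
  have hb1 : ∀ k, 1 < b k := fun k => by
    have : 0 < 1 / ((k : ℝ) + 1) := by positivity
    show 1 < 1 + 1 / ((k : ℝ) + 1)
    linarith
  have hb0 : ∀ k, 0 < b k := fun k => one_pos.trans (hb1 k)
  have hbs : ∀ k, b (k + 1) < b k := fun k => by
    have : 1 / (((k + 1 : ℕ) : ℝ) + 1) < 1 / ((k : ℝ) + 1) := by
      apply one_div_lt_one_div_of_lt (by positivity)
      push_cast; linarith
    show 1 + 1 / (((k + 1 : ℕ) : ℝ) + 1) < 1 + 1 / ((k : ℝ) + 1)
    linarith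
  have hblim : Tendsto b atTop (𝓝 1) := by
    have := (tendsto_one_div_add_atTop_nhds_zero_nat (𝕜 := ℝ)).const_add 1
    rw [add_zero] at this
    exact this
  have hqlim : Tendsto (fun k => b (k + 1) / b k) atTop (𝓝 1) := by
    have := ((tendsto_add_atTop_iff_nat 1).2 hblim).div hblim one_ne_zero
    rw [div_one] at this
    exact this
  obtain ⟨E, e, hmono, heE, hxE, he1, hE⟩ := exists_system hZ x (fun k => b (k + 1) / b k)
    (fun k => div_pos (hb0 _) (hb0 _)) (fun k => (div_lt_one (hb0 _)).2 (hbs k))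
  let n : ℕ → ℕ := fun k => (Nat.unpair k).1
  have hn : ∀ k, n k ≤ k := fun k => Nat.unpair_left_le k
  -- asymptotic property
  have hasym : ∀ z : Z, ∀ η > 0, ∀ᶠ k in atTop, ‖z‖ + 1 - η < ‖z + e k‖ := by
    intro z η hη
    set c := ‖z‖ + 1 with hc
    have hc0 : 0 < c := by positivity
    obtain ⟨j, hj⟩ := hxd (c⁻¹ • z) (by
      rw [norm_smul, norm_inv, Real.norm_of_nonneg hc0.le, inv_mul_le_iff₀ hc0]; linarith)
      (η / 4 / c) (by positivity)
    have hj' : ‖z - c • x j‖ < η / 4 := by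
      have : z - c • x j = c • (c⁻¹ • z - x j) := by rw [smul_sub, smul_inv_smul₀ hc0.ne']
      rw [this, norm_smul, Real.norm_of_nonneg hc0.le]
      calc c * ‖c⁻¹ • z - x j‖ < c * (η / 4 / c) := mul_lt_mul_of_pos_left hj hc0
        _ = η / 4 := by field_simp
    have hl : Tendsto (fun k => b (k + 1) / b k * (‖c • x j‖ + 1)) atTop
        (𝓝 (1 * (‖c • x j‖ + 1))) := hqlim.mul_const _
    have hev := hl.eventually (lt_mem_nhds
      (show 1 * (‖c • x j‖ + 1) - η / 4 < 1 * (‖c • x j‖ + 1) by linarith))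
    filter_upwards [hev, eventually_ge_atTop j] with k hk hjk
    have h1 := hE k (c • x j) ((E k).smul_mem _ (hxE j k hjk)) 1
    rw [abs_one, one_smul] at h1
    have h3 : ‖c • x j + e k‖ ≤ ‖z + e k‖ + ‖z - c • x j‖ := by
      have : c • x j + e k = (z + e k) - (z - c • x j) := by abel
      rw [this]; exact norm_sub_le _ _
    have h4 : ‖z‖ ≤ ‖c • x j‖ + ‖z - c • x j‖ := by
      have : z = c • x j + (z - c • x j) := by abel
      calc ‖z‖ = ‖c • x j + (z - c • x j)‖ := by rw [← this]
        _ ≤ _ := norm_add_le _ _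
    linarith
  -- extension
  have hext : ∀ (k : ℕ) (f : Z →L[ℝ] ℝ), ∃ g : Z →L[ℝ] ℝ, (∀ z ∈ E k, g z = f z) ∧
      g (e k) = f (x (n k)) ∧ ‖g‖ * b (k + 1) ≤ ‖f‖ * b k := by
    intro k f
    obtain ⟨g, h1, h2, h3⟩ := extend_step (E k) (e k) _ (div_pos (hb0 (k + 1)) (hb0 k)) (hE k) f
      (f (x (n k))) (by
        have := f.le_opNorm (x (n k))
        rw [Real.norm_eq_abs] at this
        nlinarith [hx1 (n k), norm_nonneg f])
    refine ⟨g, h1, h2, ?_⟩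
    rw [← mul_div_assoc, div_le_iff₀ (hb0 k)] at h3
    exact h3
  choose ext hext1 hext2 hext3 using hext
  have hfun : ∀ (N : ℕ) (f0 : Z →L[ℝ] ℝ), ‖f0‖ ≤ 1 → ∃ f : Z →L[ℝ] ℝ, ‖f‖ ≤ b N ∧
      (∀ z ∈ E N, f z = f0 z) ∧ ∀ k, N ≤ k → f (e k) = f (x (n k)) := by
    intro N f0 hf0
    let F : ℕ → Z →L[ℝ] ℝ := fun i => Nat.rec f0 (fun i g => ext (N + i) g) i
    have hF : ∀ i, F (i + 1) = ext (N + i) (F i) := fun i => rfl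
    have hFn : ∀ i, ‖F i‖ * b (N + i) ≤ b N := by
      intro i
      induction i with
      | zero =>
        show ‖f0‖ * b N ≤ b N
        nlinarith [hb0 N]
      | succ i ih => rw [hF]; exact (hext3 (N + i) (F i)).trans ih
    have hFE : ∀ i j, i ≤ j → ∀ z ∈ E (N + i), F j z = F i z := by
      intro i j hij
      induction j, hij using Nat.le_induction with
      | base => intro z _; rfl
      | succ j hij ih =>
        intro z hz
        rw [hF, hext1 (N + j) (F j) z (hmono (by omega) hz), ih z hz]
    obtain ⟨f, hf1, hf2⟩ := exists_limit F (b N) (fun i => by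
      nlinarith [hFn i, hb1 (N + i), norm_nonneg (F i)])
    have hfE : ∀ i, ∀ z ∈ E (N + i), f z = F i z := fun i z hz =>
      hf2 z _ ((eventually_ge_atTop i).mono fun j hj => hFE i j hj z hz)
    refine ⟨f, hf1, fun z hz => hfE 0 z hz, fun k hk => ?_⟩
    obtain ⟨i, rfl⟩ := Nat.exists_eq_add_of_le hk
    rw [hfE (i + 1) _ (heE (N + i)), hfE i _ (hxE _ _ (hn (N + i))), hF]
    exact hext2 _ _
  -- the norming subspace
  let V : Subspace ℝ (Z →L[ℝ] ℝ) :=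
    { carrier := {f | ∀ j, Tendsto (fun m => f (e (Nat.pair j m))) atTop (𝓝 (f (x j)))}
      add_mem' := fun {f g} hf hg j => by simpa using (hf j).add (hg j)
      zero_mem' := fun j => by simp
      smul_mem' := fun c f hf j => by simpa using (hf j).const_mul c }
  have hpair : ∀ j, Tendsto (fun m => Nat.pair j m) atTop atTop := fun j =>
    tendsto_atTop_mono (fun m => Nat.right_le_pair j m) tendsto_id
  refine ⟨V, fun z => ?_, fun z f hf => ?_⟩
  · set A := {r : ℝ | ∃ f ∈ V, ‖f‖ ≤ 1 ∧ r = |f z|} with hA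
    have hub : ∀ r ∈ A, r ≤ ‖z‖ := by
      rintro r ⟨f, -, hf1, rfl⟩
      simpa using f.le_of_opNorm_le hf1 z
    have hne : A.Nonempty := ⟨0, 0, V.zero_mem, by simp, by simp⟩
    refine le_antisymm ?_ (csSup_le hne hub)
    by_cases hz : z = 0
    · rw [hz, norm_zero]
      exact le_csSup_of_le ⟨_, hub⟩ ⟨0, V.zero_mem, by simp, rfl⟩ (by simp)
    have hz0 : 0 < ‖z‖ := norm_pos_iff.2 hz
    have key : ∀ η > 0, (1 - 4 * η) * ‖z‖ ≤ sSup A := by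
      intro η hη
      set w := ‖z‖⁻¹ • z with hw
      have hw1 : ‖w‖ = 1 := by rw [hw, norm_smul, norm_inv, norm_norm, inv_mul_cancel₀ hz0.ne']
      have hzw : z = ‖z‖ • w := by rw [hw, smul_inv_smul₀ hz0.ne']
      obtain ⟨j, hj⟩ := hxd w hw1.le η hη
      obtain ⟨N, hN1, hN2⟩ := ((hblim.eventually (gt_mem_nhds
        (show (1 : ℝ) < 1 + η by linarith))).and (eventually_ge_atTop j)).exists
      obtain ⟨f0, hf0, hf0w⟩ := exists_dual_vector'' ℝ w
      have hf0w' : f0 w = 1 := by rw [hf0w, hw1]; simp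
      obtain ⟨f, hf1, hf2, hf3⟩ := hfun N f0 hf0
      have hfV : f ∈ V := fun j => by
        refine Tendsto.congr' ?_ tendsto_const_nhds
        filter_upwards [(hpair j).eventually (eventually_ge_atTop N)] with m hm
        rw [hf3 _ hm]; simp [n]
      have h1 : f (x j) = f0 (x j) := hf2 _ (hxE j N hN2)
      have h2 : |f0 (w - x j)| ≤ 1 * ‖w - x j‖ := f0.le_of_opNorm_le hf0 _
      have h3 : |f (w - x j)| ≤ b N * ‖w - x j‖ := f.le_of_opNorm_le hf1 _
      rw [map_sub] at h2 h3
      have h4 := abs_le.1 h2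
      have h5 := abs_le.1 h3
      have h6 : b N * ‖w - x j‖ ≤ (1 + η) * η :=
        mul_le_mul hN1.le hj.le (norm_nonneg _) (by linarith)
      have h7 : 1 - η - (1 + η) * η ≤ f w := by linarith
      have h8 : (1 - 4 * η) * b N ≤ f w := by
        rcases le_total 0 (1 - 4 * η) with h | h
        · nlinarith
        · by_cases h' : 0 ≤ 1 - η - (1 + η) * η
          · nlinarith [hb0 N]
          · nlinarith [hb1 N]
      refine le_csSup_of_le ⟨_, hub⟩ ⟨(b N)⁻¹ • f, V.smul_mem _ hfV, ?_, rfl⟩ ?_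
      · rw [norm_smul, norm_inv, Real.norm_of_nonneg (hb0 N).le, inv_mul_le_iff₀ (hb0 N)]
        linarith
      · refine le_trans ?_ (le_abs_self _)
        have : ((b N)⁻¹ • f) z = f w / b N * ‖z‖ := by
          conv_lhs => rw [hzw]
          simp [div_eq_inv_mul]; ring
        rw [this]
        exact mul_le_mul_of_nonneg_right ((le_div_iff₀ (hb0 N)).2 h8) hz0.le
    by_contra! hc
    have := key ((‖z‖ - sSup A) / (8 * ‖z‖)) (by
      apply div_pos <;> linarith)
    have h2 : (1 - 4 * ((‖z‖ - sSup A) / (8 * ‖z‖))) * ‖z‖ = ‖z‖ - (‖z‖ - sSup A) / 2 := by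
      field_simp; ring
    linarith
  · rw [ContinuousLinearMap.norm_smulRight_apply]
    apply le_antisymm
    · refine (norm_add_le _ _).trans ?_
      rw [ContinuousLinearMap.norm_smulRight_apply]
      have := ContinuousLinearMap.norm_id_le (𝕜 := ℝ) (E := Z)
      linarith
    set Q := ‖ContinuousLinearMap.id ℝ Z + ContinuousLinearMap.smulRight f z‖ with hQ
    have key : ∀ η > 0, 1 + ‖f‖ * ‖z‖ - η * (1 + ‖z‖) ≤ Q := by
      intro η hη
      obtain ⟨u, hu, hfu⟩ : ∃ u, ‖u‖ ≤ 1 ∧ ‖f‖ - η / 2 < f u := by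
        obtain ⟨u, hu, hfu⟩ := exists_ball_lt f (‖f‖ - η / 2) (by linarith)
        rw [Real.norm_eq_abs] at hfu
        rcases abs_cases (f u) with h | h
        · exact ⟨u, hu, by linarith⟩
        · exact ⟨-u, by simpa using hu, by rw [map_neg]; linarith⟩
      obtain ⟨j, hj⟩ : ∃ j, ‖f‖ - η < f (x j) := by
        obtain ⟨j, hj⟩ := hxd u hu (η / 2 / (‖f‖ + 1)) (by positivity)
        refine ⟨j, ?_⟩
        have h1 := f.le_opNorm (u - x j)
        rw [map_sub, Real.norm_eq_abs] at h1
        have h2 := le_abs_self (f u - f (x j))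
        rw [lt_div_iff₀ (by positivity)] at hj
        nlinarith [norm_nonneg (u - x j)]
      obtain ⟨m, hm1, hm2⟩ := (((hf j).eventually (lt_mem_nhds hj)).and
        ((hpair j).eventually (hasym (‖f‖ • z) η hη))).exists
      set v := e (Nat.pair j m) with hv
      have hv1 : ‖v‖ ≤ 1 := he1 _
      have hfv : f v ≤ ‖f‖ := by
        have := f.le_opNorm v
        have := (le_abs_self (f v)).trans this
        nlinarith [norm_nonneg f]
      have h1 : ‖v + f v • z‖ ≤ Q := by
        have := (ContinuousLinearMap.id ℝ Z + ContinuousLinearMap.smulRight f z).le_opNorm v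
        have h2 : (ContinuousLinearMap.id ℝ Z + ContinuousLinearMap.smulRight f z) v
          = v + f v • z := by simp
        rw [h2, ← hQ] at this
        have hQ0 : 0 ≤ Q := norm_nonneg _
        nlinarith
      have h2 : ‖‖f‖ • z + v‖ ≤ ‖v + f v • z‖ + (‖f‖ - f v) * ‖z‖ := by
        have : ‖f‖ • z + v = (v + f v • z) + (‖f‖ - f v) • z := by rw [sub_smul]; abel
        rw [this]
        refine (norm_add_le _ _).trans ?_
        rw [norm_smul (‖f‖ - f v), Real.norm_of_nonneg (by linarith)]
      rw [norm_smul, norm_norm] at hm2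
      nlinarith [norm_nonneg z]
    by_contra! hc
    have hp : 0 < 1 + ‖z‖ := by positivity
    have := key ((1 + ‖f‖ * ‖z‖ - Q) / (2 * (1 + ‖z‖))) (by
      apply div_pos <;> linarith)
    have h2 : (1 + ‖f‖ * ‖z‖ - Q) / (2 * (1 + ‖z‖)) * (1 + ‖z‖) = (1 + ‖f‖ * ‖z‖ - Q) / 2 := by
      field_simp
    linarith

/-- `WithLp 1 (X × Y)` is the ℓ₁-sum `X ⊕₁ Y` with norm `‖(x,y)‖ = ‖x‖ + ‖y‖`. -/
theorem stmt_6 {X Y : Type*} [NormedAddCommGroup X] [NormedSpace ℝ X]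
    [CompleteSpace X] [TopologicalSpace.SeparableSpace X]
    [NormedAddCommGroup Y] [NormedSpace ℝ Y]
    [CompleteSpace Y] [TopologicalSpace.SeparableSpace Y]
    (hX : AlmostDaugavet X) :
    AlmostDaugavet (WithLp 1 (X × Y)) := by
  exact almostDaugavet_of_finProp (finProp_sum (finProp_of_almostDaugavet hX))
end

section
/- Let X be a separable almost Daugavet space and Z a closed subspace of X such that the quotient X/Z contains no isomorphic copy of ℓ1. Then Z has the almost Daugavet property. -/
open Finset Filter

/-- Finite-dimensional `ℓ₁`-thickness of the unit ball. -/
def FinThick (W : Type*) [NormedAddCommGroup W] [NormedSpace ℝ W] : Prop :=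
  ∀ F : Submodule ℝ W, FiniteDimensional ℝ F → ∀ ε : ℝ, 0 < ε →
    ∃ e : W, ‖e‖ ≤ 1 ∧ ∀ y ∈ F, ∀ a : ℝ, (1 - ε) * (‖y‖ + |a|) ≤ ‖y + a • e‖

noncomputable def thetaSeq (n : ℕ) : ℝ := ((n : ℝ) + 1) / ((n : ℝ) + 2)

lemma thetaSeq_pos (n : ℕ) : 0 < thetaSeq n := by unfold thetaSeq; positivity

lemma thetaSeq_lt_one (n : ℕ) : thetaSeq n < 1 := by
  unfold thetaSeq
  rw [div_lt_one (by positivity)]; linarith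

lemma thetaSeq_lt_succ (n : ℕ) : thetaSeq n < thetaSeq (n + 1) := by
  unfold thetaSeq
  push_cast
  rw [div_lt_div_iff₀ (by positivity) (by positivity)]
  nlinarith

lemma thetaSeq_mono : Monotone thetaSeq :=
  monotone_nat_of_le_succ fun n => (thetaSeq_lt_succ n).le

lemma exists_thetaSeq (ε : ℝ) (hε : 0 < ε) : ∃ N, ∀ n ≥ N, 1 - ε < thetaSeq n := by
  obtain ⟨N, hN⟩ := exists_nat_gt (1 / ε)
  refine ⟨N, fun n hn => lt_of_lt_of_le ?_ (thetaSeq_mono hn)⟩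
  unfold thetaSeq
  rw [lt_div_iff₀ (by positivity)]
  rw [div_lt_iff₀ hε] at hN
  nlinarith

section Seq

variable {W : Type*} [NormedAddCommGroup W] [NormedSpace ℝ W]

lemma exists_thick_seq (h : FinThick W) (G : ℕ → Submodule ℝ W)
    (hG : ∀ n, FiniteDimensional ℝ (G n)) :
    ∃ (e : ℕ → W) (F : ℕ → Submodule ℝ W), Monotone F ∧ (∀ n, G n ≤ F n) ∧
      (∀ n, e n ∈ F (n + 1)) ∧ (∀ n, ‖e n‖ ≤ 1) ∧
      ∀ n, ∀ y ∈ F n, ∀ a : ℝ,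
        thetaSeq n * (‖y‖ + |a|) ≤ thetaSeq (n + 1) * ‖y + a • e n‖ := by
  have key : ∀ (n : ℕ) (F : {F : Submodule ℝ W // FiniteDimensional ℝ F}),
      ∃ e : W, ‖e‖ ≤ 1 ∧ ∀ y ∈ F.1, ∀ a : ℝ,
        thetaSeq n * (‖y‖ + |a|) ≤ thetaSeq (n + 1) * ‖y + a • e‖ := by
    intro n F
    have h1 := thetaSeq_pos (n + 1)
    have h2 := thetaSeq_lt_succ n
    obtain ⟨e, he, H⟩ := h F.1 F.2 (1 - thetaSeq n / thetaSeq (n + 1))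
      (by rw [sub_pos, div_lt_one h1]; exact h2)
    refine ⟨e, he, fun y hy a => ?_⟩
    have := H y hy a
    rw [sub_sub_cancel, div_mul_eq_mul_div, div_le_iff₀ h1] at this
    linarith
  choose sel hsel1 hsel2 using key
  let St := {F : Submodule ℝ W // FiniteDimensional ℝ F}
  let nxt : ℕ → St → St := fun n F =>
    ⟨(F.1 ⊔ Submodule.span ℝ {sel n F}) ⊔ G (n + 1), by
      have := F.2
      have := hG (n + 1)
      infer_instance⟩
  let Fs : ℕ → St := fun n => Nat.rec (motive := fun _ => St) ⟨G 0, hG 0⟩ nxt n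
  have hs : ∀ n, Fs (n + 1) = nxt n (Fs n) := fun n => rfl
  refine ⟨fun n => sel n (Fs n), fun n => (Fs n).1, monotone_nat_of_le_succ ?_, ?_, ?_,
    fun n => hsel1 _ _, fun n => hsel2 _ _⟩
  · intro n
    rw [hs]
    exact le_sup_left.trans le_sup_left
  · intro n
    cases n with
    | zero => exact le_rfl
    | succ n => exact (le_sup_right : _ ≤ (nxt n (Fs n)).1)
  · intro n
    change sel n (Fs n) ∈ (nxt n (Fs n)).1
    have : Submodule.span ℝ {sel n (Fs n)} ≤ (nxt n (Fs n)).1 := le_sup_right.trans le_sup_left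
    exact this (Submodule.mem_span_singleton_self _)

lemma block_lower {e : ℕ → W} {F : ℕ → Submodule ℝ W} (hF : Monotone F)
    (heF : ∀ n, e n ∈ F (n + 1))
    (H : ∀ n, ∀ y ∈ F n, ∀ a : ℝ,
        thetaSeq n * (‖y‖ + |a|) ≤ thetaSeq (n + 1) * ‖y + a • e n‖)
    (N : ℕ) (y : W) (hy : y ∈ F N) (a : ℕ → ℝ) (K : ℕ) :
    y + ∑ k ∈ range K, a k • e (N + k) ∈ F (N + K) ∧
    thetaSeq N * (‖y‖ + ∑ k ∈ range K, |a k|) ≤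
      thetaSeq (N + K) * ‖y + ∑ k ∈ range K, a k • e (N + k)‖ := by
  induction K with
  | zero => simpa using hy
  | succ K ih =>
    obtain ⟨h1, h2⟩ := ih
    rw [sum_range_succ, sum_range_succ, ← add_assoc y, ← add_assoc N K 1]
    constructor
    · exact (F _).add_mem (hF (Nat.le_succ _) h1) ((F _).smul_mem _ (heF _))
    · have := H _ _ h1 (a K)
      have h3 := mul_le_mul_of_nonneg_right (thetaSeq_mono (Nat.le_add_right N K)) (abs_nonneg (a K))
      nlinarith

lemma diff_lower {e x : ℕ → W} {F : ℕ → Submodule ℝ W} (hF : Monotone F)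
    (heF : ∀ n, e n ∈ F (n + 1)) (hx : ∀ n, ‖x n‖ ≤ 1) (hxF : ∀ n, x n ∈ F n)
    (H : ∀ n, ∀ y ∈ F n, ∀ a : ℝ,
        thetaSeq n * (‖y‖ + |a|) ≤ thetaSeq (n + 1) * ‖y + a • e n‖)
    (N : ℕ) (y : W) (hy : y ∈ F N) (a : ℕ → ℝ) (K : ℕ) :
    y + ∑ k ∈ range K, a k • (e (N + k) - x (N + k)) ∈ F (N + K) ∧
    thetaSeq N * ‖y‖ ≤
      thetaSeq (N + K) * ‖y + ∑ k ∈ range K, a k • (e (N + k) - x (N + k))‖ := by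
  induction K with
  | zero => simpa using hy
  | succ K ih =>
    obtain ⟨h1, h2⟩ := ih
    rw [sum_range_succ, ← add_assoc y, ← add_assoc N K 1]
    set u := y + ∑ k ∈ range K, a k • (e (N + k) - x (N + k)) with hu
    constructor
    · exact (F _).add_mem (hF (Nat.le_succ _) h1) ((F _).smul_mem _
        ((F _).sub_mem (heF _) (hF (Nat.le_succ _) (hxF _))))
    · have h4 := H _ (u - a K • x (N + K)) ((F _).sub_mem h1 ((F _).smul_mem _ (hxF _))) (a K)
      have h5 : u - a K • x (N + K) + a K • e (N + K)
          = u + a K • (e (N + K) - x (N + K)) := by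
        rw [smul_sub]; abel
      rw [h5] at h4
      have h6 : ‖u‖ ≤ ‖u - a K • x (N + K)‖ + |a K| := by
        have h7 : ‖u‖ ≤ ‖u - a K • x (N + K)‖ + ‖a K • x (N + K)‖ := by
          simpa using norm_add_le (u - a K • x (N + K)) (a K • x (N + K))
        have h8 : ‖a K • x (N + K)‖ ≤ |a K| := by
          rw [norm_smul, Real.norm_eq_abs]
          exact mul_le_of_le_one_right (abs_nonneg _) (hx _)
        linarith
      have h9 := mul_le_mul_of_nonneg_left h6 (thetaSeq_pos (N + K)).le
      linarith

end Seq

/-! ### `ℓ₁`-sequences -/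

lemma ell_one_of_lower {Q : Type*} [NormedAddCommGroup Q] [NormedSpace ℝ Q] [CompleteSpace Q]
    (v : ℕ → Q) (hv : ∀ n, ‖v n‖ ≤ 1) (δ : ℝ) (hδ : 0 < δ)
    (H : ∀ (K : ℕ) (a : ℕ → ℝ), δ * ∑ k ∈ range K, |a k| ≤ ‖∑ k ∈ range K, a k • v k‖) :
    ∃ W : Subspace ℝ Q, IsClosed (W : Set Q) ∧
      Nonempty (W ≃L[ℝ] lp (fun _ : ℕ => ℝ) 1) := by
  have hs : ∀ a : lp (fun _ : ℕ => ℝ) 1, HasSum (fun i => |a i|) ‖a‖ := by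
    intro a
    simpa using lp.hasSum_norm (p := 1) (by simp) a
  have hb : ∀ (a : lp (fun _ : ℕ => ℝ) 1) i, ‖a i • v i‖ ≤ |a i| := by
    intro a i
    rw [norm_smul, Real.norm_eq_abs]
    exact mul_le_of_le_one_right (abs_nonneg _) (hv _)
  have hsum : ∀ a : lp (fun _ : ℕ => ℝ) 1, Summable (fun i => a i • v i) := fun a =>
    Summable.of_norm_bounded (hs a).summable (hb a)
  let T0 : lp (fun _ : ℕ => ℝ) 1 →ₗ[ℝ] Q :=
    { toFun := fun a => ∑' i, a i • v i
      map_add' := by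
        intro a b
        rw [← (hsum a).tsum_add (hsum b)]
        congr 1; ext i
        simp [add_smul]
      map_smul' := by
        intro c a
        rw [RingHom.id_apply, ← (hsum a).tsum_const_smul]
        congr 1; ext i
        simp [mul_smul] }
  have hT0 : ∀ a, ‖T0 a‖ ≤ 1 * ‖a‖ := by
    intro a
    rw [one_mul]
    exact tsum_of_norm_bounded (hs a) (hb a)
  let T := T0.mkContinuous 1 hT0
  have hlow : ∀ a, δ * ‖a‖ ≤ ‖T a‖ := by
    intro a
    have h1 : Tendsto (fun K => δ * ∑ k ∈ range K, |a k|) atTop (nhds (δ * ‖a‖)) :=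
      ((hs a).tendsto_sum_nat).const_mul δ
    have h2 : Tendsto (fun K => ‖∑ k ∈ range K, a k • v k‖) atTop (nhds ‖T a‖) :=
      ((hsum a).hasSum.tendsto_sum_nat).norm
    exact le_of_tendsto_of_tendsto' h1 h2 (fun K => H K a)
  have hanti : AntilipschitzWith (⟨δ⁻¹, (inv_pos.2 hδ).le⟩ : NNReal) T := by
    apply ContinuousLinearMap.antilipschitz_of_bound
    intro a
    have := hlow a
    change ‖a‖ ≤ δ⁻¹ * ‖T a‖
    rw [inv_mul_eq_div, le_div_iff₀ hδ]
    linarith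
  have hcl : IsClosed (Set.range T) := hanti.isClosed_range T.uniformContinuous
  exact ⟨_, hcl, ⟨(ContinuousLinearMap.equivRange hanti.injective hcl).symm⟩⟩

/-! ### From almost Daugavet to thickness -/

section Daug

variable {W : Type*} [NormedAddCommGroup W] [NormedSpace ℝ W]

lemma exists_norming {Y : Subspace ℝ (W →L[ℝ] ℝ)} (hY : IsNormingSubspace Y) (x : W) (η : ℝ)
    (hη : 0 < η) : ∃ g ∈ Y, ‖g‖ ≤ 1 ∧ ‖x‖ - η < g x := by
  have h := hY x
  have hne : {r : ℝ | ∃ f ∈ Y, ‖f‖ ≤ 1 ∧ r = |f x|}.Nonempty :=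
    ⟨|(0 : W →L[ℝ] ℝ) x|, 0, Y.zero_mem, by simp, rfl⟩
  obtain ⟨r, ⟨f, hf, hf1, rfl⟩, hr⟩ := exists_lt_of_lt_csSup hne
    (show ‖x‖ - η < _ by rw [← h]; linarith)
  rcases le_total 0 (f x) with h0 | h0
  · exact ⟨f, hf, hf1, by rwa [abs_of_nonneg h0] at hr⟩
  · exact ⟨-f, Y.neg_mem hf, by simpa using hf1, by
      rw [abs_of_nonpos h0] at hr; simpa using hr⟩

lemma daug_step {Y : Subspace ℝ (W →L[ℝ] ℝ)} (hY : IsNormingSubspace Y) (hD : HasDaugavetWrt Y)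
    (f : W →L[ℝ] ℝ) (hf : f ∈ Y) (hf1 : ‖f‖ = 1) (δ : ℝ) (hδ : 0 < δ) (ε : ℝ) (hε : 0 < ε)
    (x : W) (hx : ‖x‖ = 1) :
    ∃ h ∈ Y, ‖h‖ = 1 ∧ ∃ δ' > 0, ∀ y, ‖y‖ ≤ 1 → 1 - δ' < h y →
      1 - δ < f y ∧ 2 - ε < ‖x + y‖ := by
  obtain ⟨η, hη, hη1, hη2, hη3⟩ : ∃ η : ℝ, 0 < η ∧ 2 * η ≤ 1 ∧ 2 * η ≤ δ ∧ 2 * η ≤ ε := by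
    refine ⟨min (1 / 2) (min (δ / 2) (ε / 2)), by positivity, ?_, ?_, ?_⟩
    · have := min_le_left (1 / 2 : ℝ) (min (δ / 2) (ε / 2)); linarith
    · have := (min_le_right (1 / 2 : ℝ) (min (δ / 2) (ε / 2))).trans (min_le_left _ _); linarith
    · have := (min_le_right (1 / 2 : ℝ) (min (δ / 2) (ε / 2))).trans (min_le_right _ _); linarith
  have h1 := hD x f hf
  rw [ContinuousLinearMap.norm_smulRight_apply, hf1, hx] at h1
  obtain ⟨y0, hy0, hy0'⟩ := ContinuousLinearMap.exists_lt_apply_of_lt_opNorm _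
    (show 2 - η / 2 < _ by rw [h1]; linarith)
  simp only [ContinuousLinearMap.add_apply, ContinuousLinearMap.id_apply,
    ContinuousLinearMap.smulRight_apply] at hy0'
  obtain ⟨g0, hg0Y, hg01, hg0⟩ := exists_norming hY (y0 + f y0 • x) (η / 2) (by positivity)
  -- flip signs
  obtain ⟨g, z, hgY, hg1, hz, hgx, hg⟩ : ∃ (g : W →L[ℝ] ℝ) (z : W), g ∈ Y ∧ ‖g‖ ≤ 1 ∧ ‖z‖ ≤ 1 ∧
      0 ≤ g x ∧ 2 - η < g z + f z * g x := by
    have h2 : 2 - η < g0 y0 + f y0 * g0 x := by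
      simp only [map_add, map_smul, smul_eq_mul] at hg0
      linarith
    rcases le_total 0 (g0 x) with h0 | h0
    · exact ⟨g0, y0, hg0Y, hg01, hy0.le, h0, h2⟩
    · refine ⟨-g0, -y0, Y.neg_mem hg0Y, by simpa using hg01, by simpa using hy0.le, by simpa using h0, ?_⟩
      simpa using h2
  have bnd : ∀ (k : W →L[ℝ] ℝ), ‖k‖ ≤ 1 → ∀ y : W, ‖y‖ ≤ 1 → k y ≤ 1 := fun k hk y hy =>
    (le_abs_self _).trans ((k.le_opNorm y).trans (mul_le_one₀ hk (norm_nonneg _) hy))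
  have hgx1 : g x ≤ 1 := bnd g hg1 x hx.le
  set h := g + g x • f with hh
  have hhY : h ∈ Y := Y.add_mem hgY (Y.smul_mem _ hf)
  have happ : ∀ y, h y = g y + g x * f y := fun y => by simp [hh]
  have hnorm : 2 - η < ‖h‖ := by
    have : h z ≤ ‖h‖ := (le_abs_self _).trans ((h.le_opNorm z).trans
      (mul_le_of_le_one_right (norm_nonneg _) hz))
    rw [happ] at this
    linarith
  have hpos : 0 < ‖h‖ := by linarith
  have hnorm2 : ‖h‖ ≤ 2 := by
    refine (norm_add_le _ _).trans ?_
    rw [norm_smul, hf1, Real.norm_eq_abs, abs_of_nonneg hgx]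
    linarith
  refine ⟨‖h‖⁻¹ • h, Y.smul_mem _ hhY, by rw [norm_smul, norm_inv, norm_norm, inv_mul_cancel₀ hpos.ne'],
    η / 2, by positivity, fun y hy hyh => ?_⟩
  rw [ContinuousLinearMap.smul_apply, smul_eq_mul, inv_mul_eq_div, lt_div_iff₀ hpos, happ] at hyh
  have h3 : 2 - 2 * η < g y + g x * f y := by nlinarith
  have hfy := bnd f hf1.le y hy
  have hgy := bnd g hg1 y hy
  constructor
  · by_contra hcon
    push Not at hcon
    nlinarith [mul_le_mul_of_nonneg_left hcon hgx]
  · have h4 : g (x + y) ≤ ‖x + y‖ := (le_abs_self _).trans ((g.le_opNorm _).trans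
      (mul_le_of_le_one_left (norm_nonneg _) hg1))
    rw [map_add] at h4
    nlinarith [mul_le_mul_of_nonneg_left hfy hgx]

lemma daug_list {Y : Subspace ℝ (W →L[ℝ] ℝ)} (hY : IsNormingSubspace Y) (hD : HasDaugavetWrt Y)
    (ε : ℝ) (hε : 0 < ε) (L : List W) (hL : ∀ x ∈ L, ‖x‖ = 1) :
    ∀ (f : W →L[ℝ] ℝ), f ∈ Y → ‖f‖ = 1 → ∀ δ : ℝ, 0 < δ →
    ∃ y, ‖y‖ ≤ 1 ∧ 1 - δ < f y ∧ ∀ x ∈ L, 2 - ε < ‖x + y‖ := by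
  induction L with
  | nil =>
    intro f hf hf1 δ hδ
    obtain ⟨y, hy, hy'⟩ := ContinuousLinearMap.exists_lt_apply_of_lt_opNorm f
      (show 1 - δ < _ by rw [hf1]; linarith)
    rw [Real.norm_eq_abs] at hy'
    rcases le_total 0 (f y) with h0 | h0
    · exact ⟨y, hy.le, by rwa [abs_of_nonneg h0] at hy', by simp⟩
    · exact ⟨-y, by simpa using hy.le, by rw [abs_of_nonpos h0] at hy'; simpa using hy', by simp⟩
  | cons x L ih =>
    intro f hf hf1 δ hδ
    obtain ⟨h, hh, hh1, δ', hδ', H⟩ := daug_step hY hD f hf hf1 δ hδ ε hε x (hL x (by simp))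
    obtain ⟨y, hy, hy1, hy2⟩ := ih (fun x hx => hL x (by simp [hx])) h hh hh1 δ' hδ'
    obtain ⟨h1, h2⟩ := H y hy hy1
    exact ⟨y, hy, h1, by simpa using ⟨h2, hy2⟩⟩

lemma finThick_of_almostDaugavet (h : AlmostDaugavet W) : FinThick W := by
  obtain ⟨Y, hY, hD⟩ := h
  -- a norm one functional in `Y`
  have hnt : ∃ w : W, w ≠ 0 := by
    by_contra hcon
    push Not at hcon
    have h1 := hD 0 0 Y.zero_mem
    have h2 : (ContinuousLinearMap.id ℝ W) = 0 := by
      ext w; simp [hcon w]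
    rw [h2] at h1
    simp at h1
  obtain ⟨w, hw⟩ := hnt
  obtain ⟨g, hgY, -, hg⟩ := exists_norming hY w ‖w‖ (norm_pos_iff.2 hw)
  have hg0 : g ≠ 0 := by
    rintro rfl
    simp at hg
  have hgp : 0 < ‖g‖ := norm_pos_iff.2 hg0
  intro F hF ε hε
  have hcomp : IsCompact (Metric.sphere (0 : F) 1) := isCompact_sphere _ _
  obtain ⟨t, hts, htf, htc⟩ := hcomp.finite_cover_balls (half_pos hε)
  obtain ⟨y, hy1, hy2, hy3⟩ := daug_list hY hD (ε / 2) (half_pos hε)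
    (htf.toFinset.toList.map (fun x : F => (x : W)))
    (by
      intro x hx
      simp only [List.mem_map, Finset.mem_toList, Set.Finite.mem_toFinset] at hx
      obtain ⟨z, hz, rfl⟩ := hx
      have := hts hz
      simpa using this)
    (‖g‖⁻¹ • g) (Y.smul_mem _ hgY)
    (by rw [norm_smul, norm_inv, norm_norm, inv_mul_cancel₀ hgp.ne']) ε hε
  have hny : 1 - ε < ‖y‖ := by
    refine hy2.trans_le ((le_abs_self _).trans (((‖g‖⁻¹ • g).le_opNorm y).trans ?_))
    rw [norm_smul, norm_inv, norm_norm, inv_mul_cancel₀ hgp.ne', one_mul]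
  have hsph : ∀ x ∈ F, ‖x‖ = 1 → 2 - ε ≤ ‖x + y‖ := by
    intro x hx hx1
    have hmem : (⟨x, hx⟩ : F) ∈ Metric.sphere (0 : F) 1 := by simpa using hx1
    have := htc hmem
    simp only [Set.mem_iUnion, Metric.mem_ball] at this
    obtain ⟨z, hz, hd⟩ := this
    have h1 : 2 - ε / 2 < ‖(z : W) + y‖ := hy3 z (by
      simp only [List.mem_map, Finset.mem_toList, Set.Finite.mem_toFinset]
      exact ⟨z, hz, rfl⟩)
    have h2 : ‖x - (z : W)‖ < ε / 2 := by
      rw [dist_eq_norm] at hd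
      exact hd
    have h3 : ‖(z : W) + y‖ ≤ ‖x + y‖ + ‖x - (z : W)‖ := by
      have := norm_sub_le (x + y) (x - (z : W))
      rwa [show x + y - (x - (z : W)) = z + y by abel] at this
    linarith
  have hposa : ∀ x ∈ F, ∀ a : ℝ, 0 ≤ a → (1 - ε) * (‖x‖ + a) ≤ ‖x + a • y‖ := by
    intro x hx a ha
    rcases eq_or_ne x 0 with rfl | hx0
    · rw [norm_zero, zero_add, zero_add, norm_smul, Real.norm_eq_abs, abs_of_nonneg ha]
      nlinarith
    have hxp : 0 < ‖x‖ := norm_pos_iff.2 hx0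
    set x1 := ‖x‖⁻¹ • x with hx1d
    have hx1 : ‖x1‖ = 1 := by rw [norm_smul, norm_inv, norm_norm, inv_mul_cancel₀ hxp.ne']
    have hxx : x = ‖x‖ • x1 := by rw [smul_smul, mul_inv_cancel₀ hxp.ne', one_smul]
    have hs := hsph x1 (F.smul_mem _ hx) hx1
    rcases le_total a ‖x‖ with hc | hc
    · have h1 : ‖‖x‖ • (x1 + y)‖ ≤ ‖x + a • y‖ + ‖(‖x‖ - a) • y‖ := by
        have : ‖x‖ • (x1 + y) = (x + a • y) + (‖x‖ - a) • y := by
          rw [smul_add, ← hxx, sub_smul]; abel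
        rw [this]; exact norm_add_le _ _
      rw [norm_smul, norm_smul, norm_norm, Real.norm_eq_abs, abs_of_nonneg (sub_nonneg.2 hc)] at h1
      have h2 := mul_le_mul_of_nonneg_left hy1 (sub_nonneg.2 hc)
      have h3 := mul_le_mul_of_nonneg_left hs hxp.le
      nlinarith
    · have h1 : ‖a • (x1 + y)‖ ≤ ‖x + a • y‖ + ‖(a - ‖x‖) • x1‖ := by
        have : a • (x1 + y) = (x + a • y) + (a - ‖x‖) • x1 := by
          rw [smul_add, sub_smul, ← hxx]; abel
        rw [this]; exact norm_add_le _ _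
      rw [norm_smul, norm_smul, Real.norm_eq_abs, Real.norm_eq_abs,
        abs_of_nonneg (sub_nonneg.2 hc), abs_of_nonneg ha, hx1] at h1
      have h3 := mul_le_mul_of_nonneg_left hs ha
      nlinarith
  refine ⟨y, hy1, fun x hx a => ?_⟩
  rcases le_total 0 a with ha | ha
  · rw [abs_of_nonneg ha]; exact hposa x hx a ha
  · have := hposa (-x) (F.neg_mem hx) (-a) (by linarith)
    rw [norm_neg, neg_smul, ← neg_add, norm_neg] at this
    rwa [abs_of_nonpos ha]

/-! ### From thickness to almost Daugavet -/

lemma almostDaugavet_of_finThick [TopologicalSpace.SeparableSpace W] (h : FinThick W) :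
    AlmostDaugavet W := by
  have : Nonempty (Metric.closedBall (0 : W) 1) := ⟨⟨0, by simp⟩⟩
  haveI : SecondCountableTopology W := UniformSpace.secondCountable_of_separable W
  let b : ℕ → W := fun n => (TopologicalSpace.denseSeq (Metric.closedBall (0 : W) 1) n : W)
  have hb1 : ∀ n, ‖b n‖ ≤ 1 := fun n => by
    have := (TopologicalSpace.denseSeq (Metric.closedBall (0 : W) 1) n).2
    rwa [mem_closedBall_zero_iff] at this
  have hbd : ∀ y : W, ‖y‖ ≤ 1 → ∀ η > 0, ∃ n, ‖y - b n‖ < η := by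
    intro y hy η hη
    obtain ⟨n, hn⟩ := Metric.denseRange_iff.1
      (TopologicalSpace.denseRange_denseSeq (Metric.closedBall (0 : W) 1)) ⟨y, by simpa using hy⟩ η hη
    refine ⟨n, ?_⟩
    rw [Subtype.dist_eq, dist_eq_norm] at hn
    exact hn
  let w : ℕ → W := TopologicalSpace.denseSeq W
  have hwd : ∀ y : W, ∀ η > 0, ∃ n, ‖y - w n‖ < η := by
    intro y η hη
    obtain ⟨n, hn⟩ := Metric.denseRange_iff.1 (TopologicalSpace.denseRange_denseSeq W) y η hη
    refine ⟨n, ?_⟩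
    rw [dist_eq_norm] at hn
    exact hn
  obtain ⟨e, F, hF, hGF, heF, he1, H⟩ := exists_thick_seq h
    (fun n => Submodule.span ℝ (b '' Set.Iic n ∪ w '' Set.Iic n))
    (fun n => FiniteDimensional.span_of_finite ℝ
      (((Set.finite_Iic n).image _).union ((Set.finite_Iic n).image _)))
  have hwF : ∀ m n, m ≤ n → w m ∈ F n := fun m n hmn =>
    hGF n (Submodule.subset_span (Or.inr ⟨m, hmn, rfl⟩))
  let x : ℕ → W := fun n => b n.unpair.1
  have hx1 : ∀ n, ‖x n‖ ≤ 1 := fun n => hb1 _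
  have hxF : ∀ n, x n ∈ F n := fun n =>
    hGF n (Submodule.subset_span (Or.inl ⟨_, Nat.unpair_left_le n, rfl⟩))
  let Y : Subspace ℝ (W →L[ℝ] ℝ) :=
    { carrier := {f | ∀ᶠ n in atTop, f (e n) = f (x n)}
      add_mem' := by
        intro f g hf hg
        filter_upwards [hf, hg] with n h1 h2
        simp [h1, h2]
      zero_mem' := by simp
      smul_mem' := by
        intro c f hf
        filter_upwards [hf] with n h1
        simp [h1] }
  have hYmem : ∀ f, f ∈ Y ↔ ∀ᶠ n in atTop, f (e n) = f (x n) := fun f => Iff.rfl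
  refine ⟨Y, ?_, ?_⟩
  · intro y
    have hub : ∀ r ∈ {r : ℝ | ∃ f ∈ Y, ‖f‖ ≤ 1 ∧ r = |f y|}, r ≤ ‖y‖ := by
      rintro r ⟨f, -, hf, rfl⟩
      exact (f.le_opNorm y).trans (mul_le_of_le_one_left (norm_nonneg _) hf)
    have hne : {r : ℝ | ∃ f ∈ Y, ‖f‖ ≤ 1 ∧ r = |f y|}.Nonempty :=
      ⟨_, 0, Y.zero_mem, by simp, rfl⟩
    refine le_antisymm ?_ (csSup_le hne hub)
    refine le_of_forall_pos_sub_le fun η hη => ?_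
    obtain ⟨j, hj⟩ := hwd y (η / 3) (by positivity)
    obtain ⟨N1, hN1⟩ := exists_thetaSeq (η / 3 / (‖w j‖ + 1)) (by positivity)
    set N := max j N1 with hN
    have hθ := hN1 N (le_max_right _ _)
    -- the quotient by the span of the differences
    set V : Submodule ℝ W := Submodule.span ℝ (Set.range fun k => e (N + k) - x (N + k)) with hV
    have hlow : thetaSeq N * ‖w j‖ ≤ ‖(Submodule.Quotient.mk (w j) : W ⧸ V)‖ := by
      by_contra hcon
      push Not at hcon
      obtain ⟨m, hm, hm'⟩ := Submodule.Quotient.norm_mk_lt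
        (Submodule.Quotient.mk (w j) : W ⧸ V) (sub_pos.2 hcon)
      rw [add_sub_cancel] at hm'
      rw [Submodule.Quotient.eq] at hm
      obtain ⟨c, hc⟩ := (Finsupp.mem_span_range_iff_exists_finsupp).1 hm
      have hsub : c.support ⊆ range (c.support.sup id + 1) := fun i hi => by
        rw [mem_range]
        exact Nat.lt_succ_of_le (Finset.le_sup (f := id) hi)
      rw [Finsupp.sum_of_support_subset _ hsub _ (by simp)] at hc
      obtain ⟨-, h2⟩ := diff_lower hF heF hx1 hxF H N (w j) (hwF j N (le_max_left _ _)) c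
        (c.support.sup id + 1)
      rw [hc, add_sub_cancel] at h2
      have := mul_le_of_le_one_left (norm_nonneg m) (thetaSeq_lt_one (N + (c.support.sup id + 1))).le
      linarith
    obtain ⟨g, hg1, hg⟩ := exists_dual_vector'' ℝ (Submodule.Quotient.mk (w j) : W ⧸ V)
    have hmkb : ∀ z : W, ‖(g.toLinearMap ∘ₗ V.mkQ) z‖ ≤ 1 * ‖z‖ := by
      intro z
      refine (g.le_opNorm _).trans ?_
      exact mul_le_mul hg1 (Submodule.Quotient.norm_mk_le V z) (norm_nonneg _) zero_le_one
    let f : W →L[ℝ] ℝ := (g.toLinearMap ∘ₗ V.mkQ).mkContinuous 1 hmkb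
    have hfapp : ∀ z, f z = g (Submodule.Quotient.mk z) := fun z => rfl
    have hf1 : ‖f‖ ≤ 1 := LinearMap.mkContinuous_norm_le _ zero_le_one _
    have hfY : f ∈ Y := by
      rw [hYmem]
      filter_upwards [eventually_ge_atTop N] with n hn
      obtain ⟨k, rfl⟩ := Nat.exists_eq_add_of_le hn
      rw [hfapp, hfapp]
      congr 1
      rw [Submodule.Quotient.eq]
      exact Submodule.subset_span ⟨k, rfl⟩
    have hle : |f y| ≤ sSup {r : ℝ | ∃ f ∈ Y, ‖f‖ ≤ 1 ∧ r = |f y|} :=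
      le_csSup ⟨_, hub⟩ ⟨f, hfY, hf1, rfl⟩
    have h1 : thetaSeq N * ‖w j‖ ≤ f (w j) := by
      rw [hfapp, hg]; exact hlow
    have h2 : f (w j) - f y ≤ η / 3 := by
      rw [← map_sub]
      refine (le_abs_self _).trans ((f.le_opNorm _).trans ?_)
      rw [norm_sub_rev]
      exact (mul_le_of_le_one_left (norm_nonneg _) hf1).trans hj.le
    have h3 : ‖w j‖ - η / 3 ≤ thetaSeq N * ‖w j‖ := by
      have h4 : η / 3 / (‖w j‖ + 1) * ‖w j‖ ≤ η / 3 := by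
        rw [div_mul_eq_mul_div, div_le_iff₀ (by positivity)]
        nlinarith [norm_nonneg (w j)]
      nlinarith [mul_le_mul_of_nonneg_right hθ.le (norm_nonneg (w j))]
    have h5 : ‖y‖ - ‖w j‖ ≤ η / 3 := (norm_sub_norm_le _ _).trans hj.le
    have := le_abs_self (f y)
    linarith
  · intro z f hf
    have hev : ∀ y : W, ∀ η > 0, ∀ᶠ n in atTop, ‖y‖ + 1 - η ≤ ‖y + e n‖ := by
      intro y η hη
      obtain ⟨j, hj⟩ := hwd y (η / 3) (by positivity)
      obtain ⟨N1, hN1⟩ := exists_thetaSeq (η / 3 / (‖w j‖ + 1)) (by positivity)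
      filter_upwards [eventually_ge_atTop (max j N1)] with n hn
      have hθ := hN1 n ((le_max_right _ _).trans hn)
      have h1 := H n (w j) (hwF j n ((le_max_left _ _).trans hn)) 1
      rw [abs_one, one_smul] at h1
      have h2 := mul_le_of_le_one_left (norm_nonneg (w j + e n)) (thetaSeq_lt_one (n + 1)).le
      have h3 : ‖w j + e n‖ ≤ ‖y + e n‖ + ‖y - w j‖ := by
        have := norm_sub_le (y + e n) (y - w j)
        rwa [show y + e n - (y - w j) = w j + e n by abel] at this
      have h5 : ‖y‖ - ‖w j‖ ≤ η / 3 := (norm_sub_norm_le _ _).trans hj.le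
      have h4 : ‖w j‖ + 1 - η / 3 ≤ thetaSeq n * (‖w j‖ + 1) := by
        have hp : 0 < ‖w j‖ + 1 := by positivity
        have h6 : η / 3 / (‖w j‖ + 1) * (‖w j‖ + 1) = η / 3 := div_mul_cancel₀ _ hp.ne'
        nlinarith [mul_le_mul_of_nonneg_right hθ.le hp.le]
      linarith
    have hid : ‖ContinuousLinearMap.id ℝ W‖ ≤ 1 := ContinuousLinearMap.norm_id_le
    refine le_antisymm ((norm_add_le _ _).trans (by linarith)) ?_
    rw [ContinuousLinearMap.norm_smulRight_apply]
    refine le_of_forall_pos_sub_le fun η hη => ?_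
    set η' := η / (2 * (‖z‖ + 1)) with hη'
    have hzp : 0 < ‖z‖ + 1 := by positivity
    have hη'p : 0 < η' := by positivity
    have hη'z : η' * ‖z‖ ≤ η / 2 := by
      rw [hη', div_mul_eq_mul_div, div_le_iff₀ (by positivity)]
      nlinarith
    -- a point of the dense sequence almost norming `f`
    obtain ⟨m, hm⟩ : ∃ m, ‖f‖ - η' < |f (b m)| := by
      obtain ⟨y, hy, hy'⟩ := ContinuousLinearMap.exists_lt_apply_of_lt_opNorm f
        (show ‖f‖ - η' < ‖f‖ by linarith)
      rw [Real.norm_eq_abs] at hy'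
      have hcont : ∃ n, ‖y - b n‖ < (|f y| - (‖f‖ - η')) / (‖f‖ + 1) :=
        hbd y hy.le _ (div_pos (by linarith) (by positivity))
      obtain ⟨n, hn⟩ := hcont
      refine ⟨n, ?_⟩
      have hfp : 0 < ‖f‖ + 1 := by positivity
      rw [lt_div_iff₀ hfp] at hn
      have h1 : |f y| - |f (b n)| ≤ ‖f‖ * ‖y - b n‖ := by
        refine (abs_sub_abs_le_abs_sub _ _).trans ?_
        rw [← map_sub]
        exact f.le_opNorm _
      nlinarith [norm_nonneg (y - b n)]
    have hboth := (hev (f (b m) • z) (η / 2) (by positivity)).and ((hYmem f).1 hf)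
    obtain ⟨N, hN⟩ := eventually_atTop.1 hboth
    obtain ⟨h1, h2⟩ := hN (Nat.pair m N) (Nat.right_le_pair m N)
    have hxm : x (Nat.pair m N) = b m := by simp [x]
    rw [hxm] at h2
    set n := Nat.pair m N
    have h3 := (ContinuousLinearMap.id ℝ W + ContinuousLinearMap.smulRight f z).le_opNorm (e n)
    simp only [ContinuousLinearMap.add_apply, ContinuousLinearMap.id_apply,
      ContinuousLinearMap.smulRight_apply] at h3
    rw [h2, add_comm (e n)] at h3
    have h4 := mul_le_of_le_one_right
      (norm_nonneg (ContinuousLinearMap.id ℝ W + ContinuousLinearMap.smulRight f z)) (he1 n)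
    rw [norm_smul, Real.norm_eq_abs] at h1
    nlinarith [mul_le_mul_of_nonneg_right hm.le (norm_nonneg z)]

end Daug

lemma finThick_subspace {X : Type*} [NormedAddCommGroup X] [NormedSpace ℝ X]
    [CompleteSpace X] (hX : FinThick X)
    (Z : Subspace ℝ X) [hZc : IsClosed (Z : Set X)]
    (hno : ¬ ∃ W : Subspace ℝ (X ⧸ Z), IsClosed (W : Set (X ⧸ Z)) ∧
      Nonempty (W ≃L[ℝ] lp (fun _ : ℕ => ℝ) 1)) : FinThick Z := by
  intro F hFd ε hε
  obtain ⟨e, Fs, hF, hGF, heF, he1, H⟩ := exists_thick_seq hX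
    (fun _ => F.map Z.subtype) (fun _ => inferInstance)
  obtain ⟨N, hN⟩ := exists_thetaSeq (ε / 2) (by positivity)
  have hθ := hN N le_rfl
  set δ := ε / 4 with hδ
  have hδp : 0 < δ := by positivity
  have hex : ∃ (K : ℕ) (a : ℕ → ℝ), ‖∑ k ∈ range K, a k • (Submodule.Quotient.mk (e (N + k)) : X ⧸ Z)‖
      < δ * ∑ k ∈ range K, |a k| := by
    by_contra hcon
    push Not at hcon
    exact hno (ell_one_of_lower (fun k => (Submodule.Quotient.mk (e (N + k)) : X ⧸ Z))
      (fun k => (Submodule.Quotient.norm_mk_le Z _).trans (he1 _)) δ hδp hcon)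
  obtain ⟨K, a', ha'⟩ := hex
  set s := ∑ k ∈ range K, |a' k| with hs
  have hsp : 0 < s := by
    have : 0 < δ * s := (norm_nonneg _).trans_lt ha'
    exact pos_of_mul_pos_right this hδp.le
  set u' : X := ∑ k ∈ range K, a' k • e (N + k) with hu'
  set u : X := s⁻¹ • u' with hu
  have hu1 : ‖u‖ ≤ 1 := by
    rw [hu, norm_smul, norm_inv, Real.norm_eq_abs, abs_of_pos hsp, inv_mul_eq_div, div_le_one hsp]
    refine (norm_sum_le _ _).trans (sum_le_sum fun k _ => ?_)
    rw [norm_smul, Real.norm_eq_abs]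
    exact mul_le_of_le_one_right (abs_nonneg _) (he1 _)
  have hmk : ‖(Submodule.Quotient.mk u : X ⧸ Z)‖ < δ := by
    have h1 : (Submodule.Quotient.mk u : X ⧸ Z)
        = s⁻¹ • ∑ k ∈ range K, a' k • (Submodule.Quotient.mk (e (N + k)) : X ⧸ Z) := by
      change Z.mkQ u = s⁻¹ • ∑ k ∈ range K, a' k • Z.mkQ (e (N + k))
      simp [hu, hu', map_smul, map_sum]
    rw [h1, norm_smul, norm_inv, Real.norm_eq_abs, abs_of_pos hsp, inv_mul_eq_div, div_lt_iff₀ hsp]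
    exact ha'
  obtain ⟨d, hd, hd'⟩ := Submodule.Quotient.norm_mk_lt (Submodule.Quotient.mk u : X ⧸ Z) (sub_pos.2 hmk)
  rw [add_sub_cancel] at hd'
  have hz : u - d ∈ Z := by
    rw [eq_comm, Submodule.Quotient.eq] at hd; exact hd
  have hulow : ∀ y ∈ Fs N, ∀ c : ℝ, thetaSeq N * (‖y‖ + |c|) ≤ ‖y + c • u‖ := by
    intro y hy c
    obtain ⟨-, h2⟩ := block_lower hF heF H N y hy (fun k => c * s⁻¹ * a' k) K
    have h3 : ∑ k ∈ range K, |c * s⁻¹ * a' k| = |c| := by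
      simp_rw [abs_mul]
      rw [← mul_sum, ← hs, abs_inv, abs_of_pos hsp, mul_assoc, inv_mul_cancel₀ hsp.ne', mul_one]
    have h4 : ∑ k ∈ range K, (c * s⁻¹ * a' k) • e (N + k) = c • u := by
      rw [hu, hu', smul_smul, smul_sum]
      exact sum_congr rfl fun k _ => by rw [mul_smul]
    rw [h3, h4] at h2
    exact h2.trans (mul_le_of_le_one_left (norm_nonneg _) (thetaSeq_lt_one _).le)
  have hud : ‖u - d‖ ≤ 1 + δ := (norm_sub_le _ _).trans (by linarith)
  have h1δ : 0 < 1 + δ := by linarith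
  set z : X := (1 + δ)⁻¹ • (u - d) with hzdef
  have hzn : ‖z‖ ≤ 1 := by
    rw [hzdef, norm_smul, norm_inv, Real.norm_eq_abs, abs_of_pos h1δ, inv_mul_eq_div, div_le_one h1δ]
    exact hud
  have huz : ‖u - z‖ ≤ 2 * δ := by
    have h1 : u - z = d + δ • z := by
      have : (1 + δ) • z = u - d := by rw [hzdef, smul_smul, mul_inv_cancel₀ h1δ.ne', one_smul]
      rw [add_smul, one_smul] at this
      have h2 : δ • z = u - d - z := by rw [← this]; abel
      rw [h2]; abel
    rw [h1]
    refine (norm_add_le _ _).trans ?_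
    rw [norm_smul, Real.norm_eq_abs, abs_of_pos hδp]
    nlinarith
  refine ⟨⟨z, Z.smul_mem _ hz⟩, hzn, fun y hy c => ?_⟩
  have h1 := hulow (y : X) (hGF N ⟨y, hy, rfl⟩) c
  change (1 - ε) * (‖(y : X)‖ + |c|) ≤ ‖(y : X) + c • z‖
  have h2 : ‖(y : X) + c • u‖ ≤ ‖(y : X) + c • z‖ + |c| * (2 * δ) := by
    have : (y : X) + c • u = ((y : X) + c • z) + c • (u - z) := by rw [smul_sub]; abel
    rw [this]
    refine (norm_add_le _ _).trans ?_
    rw [norm_smul, Real.norm_eq_abs]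
    gcongr
  have h3 := norm_nonneg (y : X)
  have h4 := abs_nonneg c
  have h5 := mul_le_mul_of_nonneg_right hθ.le (add_nonneg h3 h4)
  nlinarith

theorem stmt_10 {X : Type*} [NormedAddCommGroup X] [NormedSpace ℝ X]
    [CompleteSpace X] [TopologicalSpace.SeparableSpace X]
    (hX : AlmostDaugavet X)
    (Z : Subspace ℝ X) [hZc : IsClosed (Z : Set X)]
    (hno : ¬ ∃ W : Subspace ℝ (X ⧸ Z), IsClosed (W : Set (X ⧸ Z)) ∧
      Nonempty (W ≃L[ℝ] lp (fun _ : ℕ => ℝ) 1)) :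
    AlmostDaugavet Z := by
  haveI : SecondCountableTopology X := UniformSpace.secondCountable_of_separable X
  exact almostDaugavet_of_finThick (finThick_subspace (finThick_of_almostDaugavet hX) Z hno)
end
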